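/- For every real h and all T, T' ≥ 0, one has F_{T+T'+1}(h) ≤ F_T(h) · F_{T'}(h). (This follows because the correlation function of the Slepian process vanishes outside [−1,1], so the restrictions of S to [0,T] and to [T+1, T+T'+1] are independent, and S is stationary.) -/

import Mathlib

open MeasureTheory ProbabilityTheory Real Set Filter

/-- The standard normal density `φ(x) = (2π)^{-1/2} exp(-x²/2)`. -/
noncomputable def stdPhi (x : ℝ) : ℝ := (Real.sqrt (2 * Real.pi))⁻¹ * Real.exp (-x ^ 2 / 2)

/-- The standard normal distribution function `Φ(x) = ∫_{-∞}^x φ(t) dt`. -/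
noncomputable def stdCdf (x : ℝ) : ℝ := ∫ t in Set.Iic x, stdPhi t

/-- `S` is a Slepian process on the probability space `(Ω, μ)`: a stationary Gaussian
process with continuous sample paths, mean zero and covariance
`E[S(t)S(t')] = max 0 (1 - |t - t'|)` (e.g. `S(t) = W(t+1) - W(t)` for a standard
Brownian motion `W`). -/
def IsSlepian {Ω : Type*} [MeasurableSpace Ω] (μ : Measure Ω) (S : ℝ → Ω → ℝ) : Prop :=
  IsProbabilityMeasure μ ∧
  (∀ t, Measurable (S t)) ∧
  (∀ ω, Continuous fun t => S t ω) ∧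
  (∀ (n : ℕ) (t c : Fin n → ℝ), ∃ v : NNReal,
      Measure.map (fun ω => ∑ i, c i * S (t i) ω) μ = gaussianReal 0 v) ∧
  (∀ t, ∫ ω, S t ω ∂μ = 0) ∧
  (∀ t t', ∫ ω, S t ω * S t' ω ∂μ = max 0 (1 - |t - t'|))

/-- `F_T(h)`: the probability that the process `S` stays below `h` on `[0, T]`. -/
noncomputable def slepF {Ω : Type*} [MeasurableSpace Ω] (μ : Measure Ω)
    (S : ℝ → Ω → ℝ) (T h : ℝ) : ℝ :=
  (μ {ω | ∀ t ∈ Set.Icc (0 : ℝ) T, S t ω < h}).toReal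

theorem exists_coeff_strongDual_pi {ι : Type*} [Fintype ι] (L : StrongDual ℝ (ι → ℝ)) :
    ∃ c : ι → ℝ, ∀ x, L x = ∑ i, c i * x i := by
  classical
  exact ⟨fun i => L fun j => if i = j then 1 else 0, fun x => by
    simpa [mul_comm] using LinearMap.pi_apply_eq_sum_univ L.toLinearMap x⟩

/-- Two Gaussian processes with the same mean and covariance functions have the same law. -/
theorem map_eq_of_integral_eq_of_covariance_eq {Ω ι : Type*} [MeasurableSpace Ω] {μ : Measure Ω}
    {X Y : ι → Ω → ℝ} (hX : IsGaussianProcess X μ) (hY : IsGaussianProcess Y μ)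
    (hXm : ∀ t, Measurable (X t)) (hYm : ∀ t, Measurable (Y t))
    (hmean : ∀ t, ∫ ω, X t ω ∂μ = ∫ ω, Y t ω ∂μ)
    (hcov : ∀ s t, cov[X s, X t; μ] = cov[Y s, Y t; μ]) :
    μ.map (fun ω t => X t ω) = μ.map (fun ω t => Y t ω) := by
  have := hX.isProbabilityMeasure
  refine (map_eq_iff_forall_finset_map_restrict_eq (measurable_pi_lambda _ hXm).aemeasurable
    (measurable_pi_lambda _ hYm).aemeasurable).2 fun I => ?_
  refine Measure.ext_of_charFunDual (funext fun L => ?_)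
  rw [(hX.hasGaussianLaw I).charFunDual_map_eq_fun, (hY.hasGaussianLaw I).charFunDual_map_eq_fun]
  obtain ⟨c, hL⟩ := exists_coeff_strongDual_pi L
  have hX2 (t : ι) : MemLp (X t) 2 μ := (hX.hasGaussianLaw_eval t).memLp_two
  have hY2 (t : ι) : MemLp (Y t) 2 μ := (hY.hasGaussianLaw_eval t).memLp_two
  have hint : ∫ ω, L (I.restrict (X · ω)) ∂μ = ∫ ω, L (I.restrict (Y · ω)) ∂μ := by
    simp only [hL, Finset.restrict]
    rw [integral_finsetSum _ fun (i : I) _ => ((hX2 i).integrable one_le_two).const_mul _,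
      integral_finsetSum _ fun (i : I) _ => ((hY2 i).integrable one_le_two).const_mul _]
    simp only [integral_const_mul, hmean]
  have hvar : Var[fun ω => L (I.restrict (X · ω)); μ] = Var[fun ω => L (I.restrict (Y · ω)); μ] := by
    simp only [hL, Finset.restrict]
    rw [← covariance_self (by fun_prop), ← covariance_self (by fun_prop),
      covariance_fun_sum_fun_sum (fun i : I => (hX2 i).const_mul _)
        fun i : I => (hX2 i).const_mul _,
      covariance_fun_sum_fun_sum (fun i : I => (hY2 i).const_mul _)
        fun i : I => (hY2 i).const_mul _]
    simp only [covariance_const_mul_left, covariance_const_mul_right, hcov]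
  rw [hint, hvar]

/-- The functions bounded away from `h` from below along a fixed dense sequence. For continuous
functions on a compact space this means being everywhere less than `h`, but unlike that condition
it is measurable for the product σ-algebra. -/
def belowOnDense (K : Type*) [TopologicalSpace K] [TopologicalSpace.SeparableSpace K] [Nonempty K]
    (h : ℝ) : Set (K → ℝ) :=
  ⋃ n : ℕ, ⋂ k : ℕ, {f | f (TopologicalSpace.denseSeq K k) ≤ h - 1 / ((n : ℝ) + 1)}

theorem measurableSet_belowOnDense (K : Type*) [TopologicalSpace K]
    [TopologicalSpace.SeparableSpace K] [Nonempty K] (h : ℝ) :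
    MeasurableSet (belowOnDense K h) :=
  .iUnion fun _ => .iInter fun _ => measurableSet_le (measurable_pi_apply _) measurable_const

theorem mem_belowOnDense_iff {K : Type*} [TopologicalSpace K]
    [TopologicalSpace.SeparableSpace K] [Nonempty K] [CompactSpace K] {f : K → ℝ}
    (hf : Continuous f) (h : ℝ) : f ∈ belowOnDense K h ↔ ∀ t, f t < h := by
  simp only [belowOnDense, mem_iUnion, mem_iInter, mem_ofPred_eq]
  constructor
  · rintro ⟨n, hn⟩ t
    have hle : f t ≤ h - 1 / ((n : ℝ) + 1) :=
      (TopologicalSpace.denseRange_denseSeq K).induction_on t (isClosed_le hf continuous_const) hn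
    have : (0 : ℝ) < 1 / ((n : ℝ) + 1) := by positivity
    linarith
  · intro hlt
    obtain ⟨t, -, ht⟩ := isCompact_univ.exists_isMaxOn univ_nonempty hf.continuousOn
    obtain ⟨n, hn⟩ := exists_nat_one_div_lt (sub_pos.2 (hlt t))
    exact ⟨n, fun k => by linarith [isMaxOn_iff.1 ht (TopologicalSpace.denseSeq K k) (mem_univ _)]⟩

namespace IsSlepian

variable {Ω : Type*} [MeasurableSpace Ω] {μ : Measure Ω} {S : ℝ → Ω → ℝ}

theorem isGaussianProcess (hS : IsSlepian μ S) : IsGaussianProcess S μ := by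
  obtain ⟨_, hmeas, -, hgauss, -, -⟩ := hS
  refine ⟨fun I => ⟨isGaussian_of_map_eq_gaussianReal fun L => ?_⟩⟩
  obtain ⟨c, hc⟩ := exists_coeff_strongDual_pi L
  obtain ⟨v, hv⟩ := hgauss (Fintype.card I) (fun i => ((Fintype.equivFin I).symm i : ℝ))
    fun i => c ((Fintype.equivFin I).symm i)
  refine ⟨0, v, ?_⟩
  rw [Measure.map_map (by fun_prop) (by fun_prop), ← hv]
  congr 1
  ext ω
  rw [(Fintype.equivFin I).symm.sum_comp fun i : I => c i * S i ω, Function.comp_apply, hc]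
  rfl

theorem covariance_eq (hS : IsSlepian μ S) (s t : ℝ) :
    cov[S s, S t; μ] = max 0 (1 - |s - t|) := by
  have := hS.1
  have hG := hS.isGaussianProcess
  rw [covariance_eq_sub (hG.hasGaussianLaw_eval s).memLp_two (hG.hasGaussianLaw_eval t).memLp_two]
  simp [hS.2.2.2.2.1, hS.2.2.2.2.2]

/-- A Slepian process is stationary: its restrictions to translates of `A` have the same law. -/
theorem map_restrict_shift_eq (hS : IsSlepian μ S) (A : Set ℝ) (a : ℝ) :
    μ.map (fun ω (t : A) => S (a + t) ω) = μ.map (fun ω (t : A) => S t ω) :=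
  map_eq_of_integral_eq_of_covariance_eq
    (hS.isGaussianProcess.comp_right fun t : A => a + (t : ℝ))
    (hS.isGaussianProcess.comp_right fun t : A => (t : ℝ))
    (fun _ => hS.2.1 _) (fun _ => hS.2.1 _) (fun t => by simp [hS.2.2.2.2.1])
    fun s t => by simp [hS.covariance_eq]

/-- The restriction of a Slepian process to `A` and its restriction to the translate `a + B` are
independent as soon as all points of `A` are at distance at least `1` from those of `a + B`. -/
theorem indepFun_restrict_shift (hS : IsSlepian μ S) {A B : Set ℝ} {a : ℝ}
    (hAB : ∀ s ∈ A, ∀ t ∈ B, 1 ≤ |s - (a + t)|) :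
    IndepFun (fun ω (s : A) => S s ω) (fun ω (t : B) => S (a + t) ω) μ := by
  refine IsGaussianProcess.indepFun_of_covariance_eq_zero (X := fun s : A => S s)
    (Y := fun t : B => S (a + t)) ?_ (fun _ => (hS.2.1 _).aemeasurable)
    (fun _ => (hS.2.1 _).aemeasurable) fun s t => ?_
  · have hcomp : Sum.elim (fun s : A => S s) (fun t : B => S (a + t))
        = S ∘ Sum.elim (fun s : A => (s : ℝ)) fun t : B => a + (t : ℝ) := by
      rw [Sum.comp_elim]
      rfl
    exact hcomp ▸ hS.isGaussianProcess.comp_right _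
  · rw [hS.covariance_eq, max_eq_left (by linarith [hAB s s.2 t t.2])]

theorem slepF_eq (hS : IsSlepian μ S) {T : ℝ} [Nonempty (Icc (0 : ℝ) T)] (h : ℝ) :
    slepF μ S T h
      = (μ ((fun ω (t : Icc (0 : ℝ) T) => S t ω) ⁻¹' belowOnDense (Icc (0 : ℝ) T) h)).toReal := by
  unfold slepF
  congr 2
  ext ω
  refine .trans ?_ (mem_belowOnDense_iff ((hS.2.2.1 ω).comp continuous_subtype_val) h).symm
  simp

end IsSlepian

/-- For all `T, T' ≥ 0`, `F_{T+T'+1}(h) ≤ F_T(h) ⬝ F_{T'}(h)`, since the correlation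
function of the Slepian process vanishes outside `[-1, 1]`. -/
theorem slepF_subadditive_shifted {Ω : Type*} [MeasurableSpace Ω] (μ : Measure Ω)
    (S : ℝ → Ω → ℝ) (hS : IsSlepian μ S) (h T T' : ℝ) (hT : 0 ≤ T) (hT' : 0 ≤ T') :
    slepF μ S (T + T' + 1) h ≤ slepF μ S T h * slepF μ S T' h := by
  have := hS.1
  have hmeas := hS.2.1
  have : Nonempty (Icc (0 : ℝ) T) := ⟨⟨0, le_rfl, hT⟩⟩
  have : Nonempty (Icc (0 : ℝ) T') := ⟨⟨0, le_rfl, hT'⟩⟩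
  have hA := measurableSet_belowOnDense (Icc (0 : ℝ) T) h
  have hB := measurableSet_belowOnDense (Icc (0 : ℝ) T') h
  have hdist : ∀ s ∈ Icc 0 T, ∀ t ∈ Icc 0 T', 1 ≤ |s - (T + 1 + t)| := fun s hs t ht =>
    le_abs.2 (.inr (by linarith [hs.2, ht.1]))
  rw [hS.slepF_eq h (T := T), hS.slepF_eq h (T := T'),
    ← Measure.map_apply (f := fun ω (t : Icc (0 : ℝ) T') => S t ω) (by fun_prop) hB,
    ← hS.map_restrict_shift_eq _ (T + 1), Measure.map_apply (by fun_prop) hB, ← ENNReal.toReal_mul,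
    ← (hS.indepFun_restrict_shift hdist).measure_inter_preimage_eq_mul _ _ hA hB]
  refine ENNReal.toReal_mono (measure_ne_top _ _) (measure_mono fun ω hω => ⟨?_, ?_⟩)
  · exact (mem_belowOnDense_iff ((hS.2.2.1 ω).comp continuous_subtype_val) h).2 fun t =>
      hω t ⟨t.2.1, by linarith [t.2.2]⟩
  · exact (mem_belowOnDense_iff
      ((hS.2.2.1 ω).comp (continuous_const.add continuous_subtype_val)) h).2 fun t =>
      hω (T + 1 + t) ⟨by linarith [t.2.1], by linarith [t.2.2]⟩
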